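/- Let (G,E) be a self-similar action. The following are equivalent: (1) (G,E) is pseudo free, i.e. no g ∈ G∖G⁰ strongly fixes an edge; (2) no g ∈ G∖G⁰ strongly fixes any path in s(g)E^*; (3) for every α ∈ E^* and all g,h ∈ G with s(g) = s(h) = r(α): g·α = h·α and g|_α = h|_α imply g = h; (4) the inverse semigroup S(G,E) is E*-unitary; (5) the Zappa–Szép product category E^*⋈G is right cancellative. -/

import Mathlib

noncomputable section

attribute [local instance] Classical.propDecidable

/-- Raw algebraic data of an inverse semigroup with zero, together with a domain
predicate singling out its genuine elements (the carrier may contain junk). -/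
structure RawSem (T : Type) where
  mul : T → T → T
  star : T → T
  zero : T
  dom : T → Prop

namespace RawSem

variable {T : Type} (R : RawSem T)

/-- The natural partial order: `t ≤ u` iff `t = u ⬝ t* ⬝ t`. -/
def le (t u : T) : Prop := t = R.mul u (R.mul (R.star t) t)

/-- Nonzero idempotents (belonging to the domain). -/
def NzIdem (e : T) : Prop := R.dom e ∧ R.mul e e = e ∧ e ≠ R.zero

/-- `F` covers the idempotent `e`: every nonzero idempotent below `e` meets some `f ∈ F`. -/
def Covers (F : Set T) (e : T) : Prop :=
  ∀ z, R.NzIdem z → R.le z e → ∃ f ∈ F, R.mul z f ≠ R.zero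

/-- The set `F_t` of nonzero idempotents trivially fixed by `t`, i.e. `≤ t`. -/
def TrivFix (t : T) : Set T := {e | R.NzIdem e ∧ R.le e t}

/-- The idempotent `e` is fixed by `t`:
`(t ⬝ f ⬝ t*) ⬝ f ≠ 0` for every nonzero idempotent `f ≤ e`. -/
def FixedBy (e t : T) : Prop :=
  ∀ f, R.NzIdem f → R.le f e → R.mul (R.mul (R.mul t f) (R.star t)) f ≠ R.zero

/-- The inverse semigroup is closed. -/
def Closed : Prop :=
  ∀ t, R.dom t → ∃ F : Finset T, ↑F ⊆ R.TrivFix t ∧ ∀ e ∈ R.TrivFix t, R.Covers ↑F e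

/-- The inverse semigroup is topologically free. -/
def TopFree : Prop :=
  ∀ t e, R.dom t → R.NzIdem e → R.FixedBy e t → ∃ f ∈ R.TrivFix t, R.mul f e ≠ R.zero

/-- The inverse semigroup is effective. -/
def Effective : Prop :=
  ∀ t e, R.dom t → R.NzIdem e → R.FixedBy e t →
    ∃ F : Finset T, ↑F ⊆ R.TrivFix t ∧ R.Covers (↑F) e

/-- The inverse semigroup is minimal. -/
def Minimal : Prop :=
  ∀ e f, R.NzIdem e → R.NzIdem f → ∃ Ts : Finset T, (∀ t ∈ Ts, R.dom t) ∧
    R.Covers ((fun t => R.mul (R.mul t f) (R.star t)) '' ↑Ts) e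

/-- The inverse semigroup is quasi-fundamental. -/
def QuasiFund : Prop :=
  ∀ s t, R.dom s → R.dom t → s ≠ R.zero → t ≠ R.zero →
    (∀ e, R.NzIdem e → R.mul (R.mul s e) (R.star s) = R.mul (R.mul t e) (R.star t)) →
    ∃ u, R.dom u ∧ u ≠ R.zero ∧ R.le u s ∧ R.le u t

/-- The inverse semigroup is fundamental. -/
def Fund : Prop :=
  ∀ s t, R.dom s → R.dom t →
    (∀ e, R.NzIdem e → R.mul (R.mul s e) (R.star s) = R.mul (R.mul t e) (R.star t)) → s = t

/-- The inverse semigroup is `E*`-unitary. -/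
def EUnitary : Prop := ∀ t e, R.dom t → R.NzIdem e → R.le e t → R.mul t t = t

/-- The inverse semigroup is locally contracting. -/
def LocContr : Prop :=
  ∀ e, R.NzIdem e → ∃ s, R.dom s ∧ ∃ F : Finset T, ∃ f₀ ∈ F,
    (∀ f ∈ F, R.NzIdem f ∧ R.le f (R.mul e (R.mul (R.star s) s))) ∧
    ∀ f ∈ F, R.Covers (↑F) (R.mul (R.mul s f) (R.star s)) ∧
      R.mul f₀ (R.mul (R.mul s f) (R.star s)) = R.zero

/-- The inverse semigroup is strongly locally contracting. -/
def StrLocContr : Prop :=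
  ∀ e, R.NzIdem e → ∃ s f₀ f₁, R.dom s ∧ R.NzIdem f₀ ∧ R.NzIdem f₁ ∧
    R.le f₀ f₁ ∧ R.le f₁ (R.mul e (R.mul (R.star s) s)) ∧
    R.le (R.mul (R.mul s f₁) (R.star s)) f₁ ∧
    R.mul f₀ (R.mul (R.mul s f₁) (R.star s)) = R.zero

end RawSem

/-- A self-similar action `(G, E)` of a discrete groupoid `G` on a directed graph `E`
sharing the vertex/unit set `V`, encoded by total operations together with axioms
that hold on composable inputs.  Arrows `g` have source `gs g` and range `gr g`;
edges `e` have source `es e` and range `er e`; `g · e` (written `act g e`) and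
`g |_e` (written `res g e`) are meaningful when `gs g = er e`. -/
structure SSA where
  V : Type
  G : Type
  E : Type
  gs : G → V
  gr : G → V
  es : E → V
  er : E → V
  one : V → G
  mul : G → G → G
  inv : G → G
  act : G → E → E
  res : G → E → G
  gs_one : ∀ v, gs (one v) = v
  gr_one : ∀ v, gr (one v) = v
  gs_mul : ∀ g h, gs g = gr h → gs (mul g h) = gs h
  gr_mul : ∀ g h, gs g = gr h → gr (mul g h) = gr g
  mul_assoc' : ∀ g h k, gs g = gr h → gs h = gr k → mul (mul g h) k = mul g (mul h k)
  one_mul' : ∀ g, mul (one (gr g)) g = g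
  mul_one' : ∀ g, mul g (one (gs g)) = g
  gs_inv : ∀ g, gs (inv g) = gr g
  gr_inv : ∀ g, gr (inv g) = gs g
  mul_inv' : ∀ g, mul g (inv g) = one (gr g)
  inv_mul' : ∀ g, mul (inv g) g = one (gs g)
  er_act : ∀ g e, gs g = er e → er (act g e) = gr g
  act_one : ∀ e, act (one (er e)) e = e
  act_mul : ∀ g h e, gs g = gr h → gs h = er e → act (mul g h) e = act g (act h e)
  gs_res : ∀ g e, gs g = er e → gs (res g e) = es e
  gr_res : ∀ g e, gs g = er e → gr (res g e) = es (act g e)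
  res_mul : ∀ g h e, gs g = gr h → gs h = er e →
    res (mul g h) e = mul (res g (act h e)) (res h e)

namespace SSA

/-- Finite paths in the graph: `Pth S a b` is the type of paths with range `a`
and source `b`; `cons e p` is the path `e · p`. -/
inductive Pth (S : SSA) : S.V → S.V → Type
  | nil (v : S.V) : Pth S v v
  | cons (e : S.E) {b : S.V} (p : Pth S (S.es e) b) : Pth S (S.er e) b

/-- The path category `E^*`, bundled: a finite path with its range and source. -/
structure Path (S : SSA) where
  rng : S.V
  src : S.V
  pth : S.Pth rng src

/-- Infinite paths: sequences of edges `e₁e₂⋯` with `es eᵢ = er e_{i+1}`. -/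
structure InfPath (S : SSA) where
  seq : ℕ → S.E
  chain : ∀ n, S.es (seq n) = S.er (seq (n + 1))

/-- A twist `σ = (σ_G, σ_⋈)` of the self-similar action, with values in the
unit circle `𝕋 ⊆ ℂ`. -/
structure Twist (S : SSA) where
  σG : S.G → S.G → ℂ
  σB : S.G → S.E → ℂ
  σG_unimod : ∀ g h, S.gs g = S.gr h → ‖σG g h‖ = 1
  σB_unimod : ∀ g e, S.gs g = S.er e → ‖σB g e‖ = 1
  σG_cocycle : ∀ g h k, S.gs g = S.gr h → S.gs h = S.gr k →
    σG g h * σG (S.mul g h) k = σG h k * σG g (S.mul h k)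
  σG_one_left : ∀ g, σG (S.one (S.gr g)) g = 1
  σG_one_right : ∀ g, σG g (S.one (S.gs g)) = 1
  σB_one : ∀ e, σB (S.one (S.er e)) e = 1
  σB_cocycle : ∀ g h e, S.gs g = S.gr h → S.gs h = S.er e →
    σB h e * (starRingEnd ℂ) (σB (S.mul g h) e) * σB g (S.act h e) =
      (starRingEnd ℂ) (σG (S.res g (S.act h e)) (S.res h e)) * σG g h

variable {S : SSA}

namespace Pth

def length : ∀ {a b : S.V}, S.Pth a b → ℕ
  | _, _, .nil _ => 0
  | _, _, .cons _ p => length p + 1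

def toList : ∀ {a b : S.V}, S.Pth a b → List S.E
  | _, _, .nil _ => []
  | _, _, .cons e p => e :: toList p

def comp : ∀ {a b c : S.V}, S.Pth a b → S.Pth b c → S.Pth a c
  | _, _, _, .nil _, q => q
  | _, _, _, .cons e p, q => .cons e (comp p q)

end Pth

def Path.length (p : Path S) : ℕ := p.pth.length

def Path.toList (p : Path S) : List S.E := p.pth.toList

/-- A vertex regarded as a path of length `0`. -/
def Path.vert (S : SSA) (v : S.V) : Path S := ⟨v, v, .nil v⟩

/-- An edge regarded as a path of length `1`. -/
def Path.ofEdge (S : SSA) (e : S.E) : Path S := ⟨S.er e, S.es e, .cons e (.nil (S.es e))⟩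

/-- Concatenation of paths (junk -- the first path -- when not composable). -/
def Path.comp (p q : Path S) : Path S :=
  if h : p.src = q.rng then
    ⟨p.rng, q.src, Pth.comp (cast (congrArg (S.Pth p.rng) h) p.pth) q.pth⟩
  else p

/-- `q` is a prefix of `p`, i.e. `p` extends `q`. -/
def IsPrefix (S : SSA) (q p : Path S) : Prop :=
  ∃ r : Path S, q.src = r.rng ∧ p = q.comp r

/-- Two paths are comparable if one is a prefix of the other. -/
def Comparable (S : SSA) (p q : Path S) : Prop := IsPrefix S p q ∨ IsPrefix S q p

/-- The extended left action of groupoid arrows on finite paths,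
given by the recursive recipe `g · v = r g`, `g · (e μ) = (g · e) (g|_e · μ)`. -/
def pactAux (S : SSA) : ∀ {a b : S.V}, S.G → S.Pth a b → Path S
  | _, _, g, .nil _ => Path.vert S (S.gr g)
  | _, _, g, .cons e p => (Path.ofEdge S (S.act g e)).comp (pactAux S (S.res g e) p)

/-- The extended left action `g · μ` on finite paths. -/
def pact (S : SSA) (g : S.G) (p : Path S) : Path S := pactAux S g p.pth

/-- The extended restriction map, given by `g|_v = g` and `g|_{e μ} = (g|_e)|_μ`. -/
def presAux (S : SSA) : ∀ {a b : S.V}, S.G → S.Pth a b → S.G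
  | _, _, g, .nil _ => g
  | _, _, g, .cons e p => presAux S (S.res g e) p

/-- The extended restriction map `g |_μ` on finite paths. -/
def pres (S : SSA) (g : S.G) (p : Path S) : S.G := presAux S g p.pth

/-- `g` strongly fixes the path `p` : `g · p = p` and `g|_p = s p`. -/
def SFix (S : SSA) (g : S.G) (p : Path S) : Prop :=
  S.gs g = p.rng ∧ pact S g p = p ∧ pres S g p = S.one p.src

/-- `p` is a minimal strongly `g`-fixed path. -/
def MinSFix (S : SSA) (g : S.G) (p : Path S) : Prop :=
  SFix S g p ∧ ∀ q : Path S, IsPrefix S q p → q ≠ p → ¬ SFix S g q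

/-- `g` is a unit of the groupoid (an element of `G⁰`). -/
def IsUnitArrow (S : SSA) (g : S.G) : Prop := g = S.one (S.gs g)

/-- `g` fixes every path in `s(g)E^*`. -/
def FixesAll (S : SSA) (g : S.G) : Prop :=
  ∀ p : Path S, p.rng = S.gs g → pact S g p = p

/-- Condition (Fin): every `g` admits at most finitely many minimal strongly
`g`-fixed paths. -/
def CondFin (S : SSA) : Prop := ∀ g : S.G, {p : Path S | MinSFix S g p}.Finite

/-- Condition (Evr): if `g` fixes every path in `s(g)E^*` then `g` strongly fixes
some path in `s(g)E^*`. -/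
def CondEvr (S : SSA) : Prop := ∀ g : S.G, FixesAll S g → ∃ p : Path S, SFix S g p

/-- `p` is a `g`-cycle: a path of positive length with `g · s(p) = r(p)`. -/
def GCycle (S : SSA) (g : S.G) (p : Path S) : Prop :=
  1 ≤ p.length ∧ S.gs g = p.src ∧ S.gr g = p.rng

/-- The vertex `v` receives at least two distinct edges. -/
def HasEntranceVert (S : SSA) (v : S.V) : Prop :=
  ∃ e f : S.E, e ≠ f ∧ S.er e = v ∧ S.er f = v

/-- Base vertices of a finite path. -/
def Path.baseVerts (p : Path S) : Set S.V :=
  insert p.rng {v : S.V | ∃ e ∈ p.toList, S.es e = v}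

/-- A finite path has an entrance. -/
def Path.hasEntrance (p : Path S) : Prop := ∃ v ∈ p.baseVerts, HasEntranceVert S v

/-- Condition (Cyc): every `G`-cycle has an entrance. -/
def CondCyc (S : SSA) : Prop := ∀ (g : S.G) (p : Path S), GCycle S g p → p.hasEntrance

/-- `g` has slack. -/
def HasSlack (S : SSA) (g : S.G) : Prop :=
  ∃ F : Finset (Path S), (∀ p ∈ F, SFix S g p) ∧
    ∀ q : Path S, q.rng = S.gs g → ∃ p ∈ F, Comparable S p q

/-- Condition (Sla): if `g` fixes every path in `s(g)E^*` then `g` has slack. -/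
def CondSla (S : SSA) : Prop := ∀ g : S.G, FixesAll S g → HasSlack S g

def InfPath.rng (ξ : InfPath S) : S.V := S.er (ξ.seq 0)

/-- Base vertices of an infinite path. -/
def InfPath.baseVerts (ξ : InfPath S) : Set S.V := {v : S.V | ∃ n, S.er (ξ.seq n) = v}

/-- An infinite path has an entrance. -/
def InfPath.hasEntrance (ξ : InfPath S) : Prop := ∃ v ∈ ξ.baseVerts, HasEntranceVert S v

/-- The finite path `p` is a prefix of the infinite path `ξ`. -/
def PrefixOfInf (S : SSA) (p : Path S) (ξ : InfPath S) : Prop :=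
  p.rng = ξ.rng ∧ ∀ i : ℕ, i < p.length → p.toList[i]? = some (ξ.seq i)

/-- Finite or infinite paths. -/
abbrev GenPath (S : SSA) : Type := Path S ⊕ InfPath S

/-- The finite path `p` is a prefix of the finite or infinite path `ξ`. -/
def GPrefix (S : SSA) (p : Path S) : GenPath S → Prop
  | .inl q => IsPrefix S p q
  | .inr ξ => PrefixOfInf S p ξ

/-- The set `vE¹` of edges received by the vertex `v`. -/
def recvSet (S : SSA) (v : S.V) : Set S.E := {e : S.E | S.er e = v}

/-- A vertex is singular if it is a source or an infinite receiver. -/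
def Singular (S : SSA) (v : S.V) : Prop := recvSet S v = ∅ ∨ (recvSet S v).Infinite

/-- A vertex is regular if it is not singular. -/
def Regular (S : SSA) (v : S.V) : Prop := ¬ Singular S v

/-- The preorder `v ≪ w`: there is `v'` with `vE^*v' ≠ ∅` and `v'Gw ≠ ∅`. -/
def ll (S : SSA) (v w : S.V) : Prop :=
  ∃ (p : Path S) (g : S.G), p.rng = v ∧ S.gr g = p.src ∧ S.gs g = w

/-- Cofinality of the self-similar action: for every boundary path (a finite path
with singular source, or an infinite path) and every vertex `v`, some base vertex
`w` of the path satisfies `v ≪ w`. -/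
def Cofinal (S : SSA) : Prop :=
  (∀ p : Path S, Singular S p.src → ∀ v : S.V, ∃ w ∈ p.baseVerts, ll S v w) ∧
  (∀ ξ : InfPath S, ∀ v : S.V, ∃ w ∈ ξ.baseVerts, ll S v w)

def Hereditary (S : SSA) (W : Set S.V) : Prop :=
  ∀ v ∈ W, ∀ p : Path S, p.rng = v → p.src ∈ W

def Saturated (S : SSA) (W : Set S.V) : Prop :=
  ∀ w : S.V, Regular S w → (∀ e : S.E, S.er e = w → S.es e ∈ W) → w ∈ W

def GInvariant (S : SSA) (W : Set S.V) : Prop := ∀ g : S.G, S.gs g ∈ W → S.gr g ∈ W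

/-- `(G,E)`-invariant subsets of `E⁰`: `G`-invariant, hereditary and saturated. -/
def SSAInvariant (S : SSA) (W : Set S.V) : Prop :=
  GInvariant S W ∧ Hereditary S W ∧ Saturated S W

/-- Condition (Con): every vertex is reachable from a `G`-cycle with an entrance. -/
def CondCon (S : SSA) : Prop :=
  ∀ v : S.V, ∃ p : Path S, p.rng = v ∧
    ∃ (g : S.G) (c : Path S), GCycle S g c ∧ c.hasEntrance ∧ p.src ∈ c.baseVerts

/-- The underlying set (with zero `none`) of the inverse semigroup `S(G,E)`. -/
abbrev SGE (S : SSA) : Type := Option (Path S × S.G × Path S)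

/-- Well-formedness of a triple `(α, g, β)` : `r g = s α` and `s g = s β`. -/
def SGE.wf (S : SSA) : SGE S → Prop
  | none => True
  | some (α, g, β) => S.gr g = α.src ∧ S.gs g = β.src

/-- The idempotent `f_α = (α, s α, α)`. -/
def fIdem (S : SSA) (α : Path S) : SGE S := some (α, S.one α.src, α)

/-- The involution `(α,g,β)* = (β,g⁻¹,α)` on `S(G,E)`. -/
def sgeStar (S : SSA) : SGE S → SGE S
  | none => none
  | some (α, g, β) => some (β, S.inv g, α)

/-- The multiplication of the inverse semigroup `S(G,E)`. -/
def sgeMul (S : SSA) : SGE S → SGE S → SGE S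
  | none, _ => none
  | some _, none => none
  | some (α, g, β), some (γ, h, δ) =>
    if SGE.wf S (some (α, g, β)) ∧ SGE.wf S (some (γ, h, δ)) then
      if h1 : ∃ β' : Path S, β.src = Path.rng β' ∧ γ = β.comp β' then
        some (α.comp (pact S g h1.choose), S.mul (pres S g h1.choose) h, δ)
      else if h2 : ∃ γ' : Path S, γ.src = Path.rng γ' ∧ β = γ.comp γ' then
        some (α, S.mul g (S.inv (pres S (S.inv h) h2.choose)),
          δ.comp (pact S (S.inv h) h2.choose))
      else none
    else none

/-- Membership in the subsemigroup `S₀(G,E)` (with zero): triples with `|α| = |β|`. -/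
def domS0 (S : SSA) (x : SGE S) : Prop :=
  SGE.wf S x ∧ (x = none ∨ ∃ (α : Path S) (g : S.G) (β : Path S),
    x = some (α, g, β) ∧ α.length = β.length)

/-- Membership in the subsemigroup `S₀₀(G,E)` (with zero): triples `(g·β, g|_β, β)`. -/
def domS00 (S : SSA) (x : SGE S) : Prop :=
  SGE.wf S x ∧ (x = none ∨ ∃ (g : S.G) (β : Path S),
    S.gs g = β.rng ∧ x = some (pact S g β, pres S g β, β))

/-- `S(G,E)` as raw inverse-semigroup data. -/
def sgeSem (S : SSA) : RawSem (SGE S) := ⟨sgeMul S, sgeStar S, none, SGE.wf S⟩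

/-- `S₀(G,E)` as raw inverse-semigroup data. -/
def sgeSem0 (S : SSA) : RawSem (SGE S) := ⟨sgeMul S, sgeStar S, none, domS0 S⟩

/-- `S₀₀(G,E)` as raw inverse-semigroup data. -/
def sgeSem00 (S : SSA) : RawSem (SGE S) := ⟨sgeMul S, sgeStar S, none, domS00 S⟩

/-- The inductive extension of `σ_⋈` to finite paths:
`σ_⋈(h, s h) = 1`, `σ_⋈(h, e μ) = σ_⋈(h, e) σ_⋈(h|_e, μ)`. -/
def twAux (S : SSA) (σB : S.G → S.E → ℂ) : ∀ {a b : S.V}, S.G → S.Pth a b → ℂ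
  | _, _, _, .nil _ => 1
  | _, _, g, .cons e p => σB g e * twAux S σB (S.res g e) p

/-- The extension `σ_⋈ : G * E^* → 𝕋` of a twist to finite paths. -/
def twP (S : SSA) (σB : S.G → S.E → ℂ) (g : S.G) (p : Path S) : ℂ := twAux S σB g p.pth

/-- The `2`-cocycle `ω_σ` on `S(G,E)` induced by a twist `σ` of `(G,E)`. -/
def omg (S : SSA) (T : Twist S) : SGE S → SGE S → ℂ := fun x y =>
  match x, y with
  | some (_, g, β), some (γ, h, _) =>
    if h1 : ∃ β' : Path S, β.src = Path.rng β' ∧ γ = β.comp β' then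
      twP S T.σB g h1.choose * T.σG (pres S g h1.choose) h
    else if h2 : ∃ γ' : Path S, γ.src = Path.rng γ' ∧ β = γ.comp γ' then
      T.σG g (S.inv (pres S (S.inv h) h2.choose)) * twP S T.σB h (pact S (S.inv h) h2.choose)
    else 1
  | _, _ => 1

end SSA

namespace SSA

section Aux

variable {S : SSA}

theorem comp_mk {a b c : S.V} (x : S.Pth a b) (y : S.Pth b c) :
    Path.comp (⟨a, b, x⟩ : Path S) ⟨b, c, y⟩ = ⟨a, c, x.comp y⟩ := by
  simp [Path.comp]

theorem comp_rng (p q : Path S) (h : p.src = q.rng) : (p.comp q).rng = p.rng := by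
  obtain ⟨a, b, x⟩ := p; obtain ⟨c, d, y⟩ := q
  simp only at h; subst h; rw [comp_mk]

theorem comp_src (p q : Path S) (h : p.src = q.rng) : (p.comp q).src = q.src := by
  obtain ⟨a, b, x⟩ := p; obtain ⟨c, d, y⟩ := q
  simp only at h; subst h; rw [comp_mk]

theorem pth_comp_toList {a b c : S.V} (x : S.Pth a b) (y : S.Pth b c) :
    (x.comp y).toList = x.toList ++ y.toList := by
  induction x with
  | nil v => simp [Pth.comp, Pth.toList]
  | cons e p ih => simp [Pth.comp, Pth.toList, ih]

theorem comp_toList (p q : Path S) (h : p.src = q.rng) :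
    (p.comp q).toList = p.toList ++ q.toList := by
  obtain ⟨a, b, x⟩ := p; obtain ⟨c, d, y⟩ := q
  simp only at h; subst h; rw [comp_mk]
  exact pth_comp_toList x y

theorem path_ext_aux {a b : S.V} (x : S.Pth a b) : ∀ (q : Path S), a = q.rng →
    x.toList = q.toList → (⟨a, b, x⟩ : Path S) = q := by
  induction x with
  | nil v =>
    rintro ⟨c, d, y⟩ h1 h2
    cases y with
    | nil w => simp only at h1; subst h1; rfl
    | cons e y => simp [Path.toList, Pth.toList] at h2
  | cons e p ih =>
    rintro ⟨c, d, y⟩ h1 h2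
    cases y with
    | nil w => simp [Path.toList, Pth.toList] at h2
    | cons e' y =>
      simp only [Path.toList, Pth.toList, List.cons.injEq] at h2
      obtain ⟨rfl, h3⟩ := h2
      have := ih ⟨_, _, y⟩ rfl h3
      simp only [Path.mk.injEq, true_and] at this
      obtain ⟨rfl, h4⟩ := this
      rw [eq_of_heq h4]

theorem path_ext (p q : Path S) (h1 : p.rng = q.rng) (h2 : p.toList = q.toList) : p = q :=
  path_ext_aux p.pth q h1 h2

theorem comp_vert (p : Path S) (v : S.V) (h : p.src = v) : p.comp (Path.vert S v) = p := by
  have h' : p.src = (Path.vert S v).rng := h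
  apply path_ext
  · exact comp_rng _ _ h'
  · rw [comp_toList _ _ h']; simp [Path.vert, Path.toList, Pth.toList]

theorem vert_comp (p : Path S) (v : S.V) (h : v = p.rng) : (Path.vert S v).comp p = p := by
  have h' : (Path.vert S v).src = p.rng := h
  apply path_ext
  · exact (comp_rng _ _ h').trans h
  · rw [comp_toList _ _ h']; simp [Path.vert, Path.toList, Pth.toList]

theorem eq_vert (p : Path S) (h : p.toList = []) : p = Path.vert S p.rng :=
  path_ext _ _ rfl h

/-- cancellation for paths with equal lengths of the right factors -/
theorem comp_cancel (p q p' q' : Path S) (h : p.src = q.rng) (h' : p'.src = q'.rng)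
    (e : p.comp q = p'.comp q') (hl : q.toList.length = q'.toList.length) :
    p = p' ∧ q = q' := by
  have hr := congrArg Path.rng e
  have ht := congrArg Path.toList e
  rw [comp_rng _ _ h, comp_rng _ _ h'] at hr
  rw [comp_toList _ _ h, comp_toList _ _ h'] at ht
  obtain ⟨h1, h2⟩ := List.append_inj' ht hl
  have := path_ext _ _ hr h1
  subst this
  exact ⟨rfl, path_ext _ _ (h.symm.trans h') h2⟩

theorem comp_left_cancel (p q q' : Path S) (h : p.src = q.rng) (h' : p.src = q'.rng)
    (e : p.comp q = p.comp q') : q = q' := by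
  refine (comp_cancel p q p q' h h' e ?_).2
  have ht := congrArg Path.toList e
  rw [comp_toList _ _ h, comp_toList _ _ h'] at ht
  rw [List.append_cancel_left ht]

theorem comp_eq_self (p q : Path S) (h : p.src = q.rng) (e : p.comp q = p) :
    q.toList = [] := by
  have ht := congrArg Path.toList e
  rw [comp_toList _ _ h] at ht
  simpa using ht

/-! ### groupoid facts -/

theorem inv_mul_cancel_left (g h : S.G) (w : S.gs g = S.gr h) :
    S.mul (S.inv g) (S.mul g h) = h := by
  rw [← S.mul_assoc' _ _ _ (S.gs_inv g) w, S.inv_mul', w, S.one_mul']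

theorem mul_inv_cancel_right (g h : S.G) (w : S.gs g = S.gr h) :
    S.mul (S.mul g h) (S.inv h) = g := by
  rw [S.mul_assoc' _ _ _ w (S.gr_inv h).symm, S.mul_inv', ← w, S.mul_one']

theorem mul_right_cancel (g g' h : S.G) (w : S.gs g = S.gr h) (w' : S.gs g' = S.gr h)
    (e : S.mul g h = S.mul g' h) : g = g' := by
  rw [← mul_inv_cancel_right g h w, e, mul_inv_cancel_right g' h w']

theorem idem_one (g : S.G) (w : S.gs g = S.gr g) (e : S.mul g g = g) :
    g = S.one (S.gs g) := by
  have := inv_mul_cancel_left g g w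
  rw [e, S.inv_mul'] at this
  exact this.symm

theorem one_mul_one (v : S.V) : S.mul (S.one v) (S.one v) = S.one v := by
  have := S.one_mul' (S.one v)
  rwa [S.gr_one] at this

theorem inv_one (v : S.V) : S.inv (S.one v) = S.one v := by
  have := S.one_mul' (S.inv (S.one v))
  rw [S.gr_inv, S.gs_one, S.mul_inv', S.gr_one] at this
  exact this.symm

theorem inv_inv' (g : S.G) : S.inv (S.inv g) = g := by
  have := inv_mul_cancel_left (S.inv g) g (S.gs_inv g)
  rw [S.inv_mul'] at this
  have h2 := S.mul_one' (S.inv (S.inv g))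
  rw [S.gs_inv, S.gr_inv] at h2
  exact h2.symm.trans this

theorem res_one (e : S.E) : S.res (S.one (S.er e)) e = S.one (S.es e) := by
  have w : S.gs (S.one (S.er e)) = S.er e := S.gs_one _
  have h := S.res_mul (S.one (S.er e)) (S.one (S.er e)) e (by rw [S.gs_one, S.gr_one]) w
  rw [one_mul_one, S.act_one] at h
  have h1 := S.gs_res _ _ w
  have h2 := S.gr_res _ _ w
  rw [S.act_one] at h2
  have := idem_one _ (h1.trans h2.symm) h.symm
  rw [h1] at this
  exact this

/-! ### extended action -/

theorem pact_facts {a b : S.V} (x : S.Pth a b) : ∀ g : S.G, S.gs g = a →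
    (pactAux S g x).rng = S.gr g ∧ (pactAux S g x).src = S.gr (presAux S g x) ∧
    S.gs (presAux S g x) = b ∧ (pactAux S g x).toList.length = x.toList.length := by
  induction x with
  | nil v => intro g hg; exact ⟨rfl, rfl, hg, rfl⟩
  | cons e p ih =>
    intro g hg
    obtain ⟨h1, h2, h3, h4⟩ := ih (S.res g e) (S.gs_res g e hg)
    have hc : (Path.ofEdge S (S.act g e)).src = (pactAux S (S.res g e) p).rng := by
      rw [h1, S.gr_res g e hg]; rfl
    simp only [pactAux, presAux]
    refine ⟨?_, ?_, h3, ?_⟩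
    · rw [comp_rng _ _ hc]; exact S.er_act g e hg
    · rw [comp_src _ _ hc, h2]
    · rw [comp_toList _ _ hc]
      simp [Path.ofEdge, Path.toList, Pth.toList] at h4 ⊢
      omega

theorem pact_rng (g : S.G) (p : Path S) (h : S.gs g = p.rng) : (pact S g p).rng = S.gr g :=
  (pact_facts p.pth g h).1

theorem pact_src (g : S.G) (p : Path S) (h : S.gs g = p.rng) :
    (pact S g p).src = S.gr (pres S g p) :=
  (pact_facts p.pth g h).2.1

theorem pres_gs (g : S.G) (p : Path S) (h : S.gs g = p.rng) : S.gs (pres S g p) = p.src :=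
  (pact_facts p.pth g h).2.2.1

theorem pact_len (g : S.G) (p : Path S) (h : S.gs g = p.rng) :
    (pact S g p).toList.length = p.toList.length :=
  (pact_facts p.pth g h).2.2.2

theorem pact_cons (g : S.G) (e : S.E) (q : Path S) (h : S.es e = q.rng) :
    pact S g ((Path.ofEdge S e).comp q) =
      (Path.ofEdge S (S.act g e)).comp (pact S (S.res g e) q) ∧
    pres S g ((Path.ofEdge S e).comp q) = pres S (S.res g e) q := by
  obtain ⟨c, d, y⟩ := q
  simp only at h; subst h
  rw [Path.ofEdge, comp_mk]
  exact ⟨rfl, rfl⟩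

theorem path_ind {P : Path S → Prop} (h0 : ∀ v, P (Path.vert S v))
    (h1 : ∀ e q, S.es e = q.rng → P q → P ((Path.ofEdge S e).comp q)) (p : Path S) : P p := by
  obtain ⟨a, b, x⟩ := p
  induction x with
  | nil v => exact h0 v
  | cons e p ih =>
    have := h1 e ⟨_, _, p⟩ rfl ih
    rw [Path.ofEdge, comp_mk] at this
    exact this

theorem pact_one (p : Path S) : pact S (S.one p.rng) p = p ∧
    pres S (S.one p.rng) p = S.one p.src := by
  induction p using path_ind with
  | h0 v => exact ⟨congrArg (Path.vert S) (S.gr_one v), rfl⟩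
  | h1 e q h ih =>
    obtain ⟨h1, h2⟩ := pact_cons (S.one (S.er e)) e q h
    have hr : ((Path.ofEdge S e).comp q).rng = S.er e := comp_rng _ _ h
    have hs : ((Path.ofEdge S e).comp q).src = q.src := comp_src _ _ h
    rw [hr, hs, h1, h2, S.act_one, res_one, h, ih.1, ih.2]
    exact ⟨rfl, rfl⟩

theorem pact_mul (p : Path S) : ∀ g h : S.G, S.gs g = S.gr h → S.gs h = p.rng →
    pact S (S.mul g h) p = pact S g (pact S h p) ∧
    pres S (S.mul g h) p = S.mul (pres S g (pact S h p)) (pres S h p) := by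
  induction p using path_ind with
  | h0 v =>
    intro g h w w'
    exact ⟨congrArg (Path.vert S) (S.gr_mul g h w), rfl⟩
  | h1 e q hq ih =>
    intro g h w w'
    have w2 : S.gs h = S.er e := w'.trans (comp_rng _ _ hq)
    have w3 : S.gs (S.res h e) = q.rng := (S.gs_res h e w2).trans hq
    have w4 : S.gs g = S.er (S.act h e) := by rw [S.er_act h e w2, w]
    have w5 : S.gs (S.res g (S.act h e)) = S.gr (S.res h e) := by
      rw [S.gs_res _ _ w4, S.gr_res _ _ w2]
    obtain ⟨h1, h2⟩ := pact_cons (S.mul g h) e q hq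
    obtain ⟨h3, h4⟩ := pact_cons h e q hq
    have w6 : S.es (S.act h e) = (pact S (S.res h e) q).rng := by
      rw [pact_rng _ _ w3, S.gr_res _ _ w2]
    obtain ⟨h5, h6⟩ := pact_cons g (S.act h e) (pact S (S.res h e) q) w6
    obtain ⟨i1, i2⟩ := ih _ _ w5 w3
    rw [h1, h2, h3, h4, h5, h6, S.res_mul _ _ _ w w2, S.act_mul _ _ _ w w2, i1, i2]
    exact ⟨rfl, rfl⟩

/-! ### the inverse semigroup -/

theorem sgeMul_left (α β δ β' : Path S) (g h : S.G) (h1 : S.gr g = α.src) (h2 : S.gs g = β.src)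
    (h3 : S.gr h = β'.src) (h4 : S.gs h = δ.src) (hc : β.src = β'.rng) :
    sgeMul S (some (α, g, β)) (some (β.comp β', h, δ)) =
      some (α.comp (pact S g β'), S.mul (pres S g β') h, δ) := by
  have hwf : SGE.wf S (some (α, g, β)) ∧ SGE.wf S (some (β.comp β', h, δ)) :=
    ⟨⟨h1, h2⟩, ⟨h3.trans (comp_src _ _ hc).symm, h4⟩⟩
  have hex : ∃ b : Path S, β.src = Path.rng b ∧ β.comp β' = β.comp b := ⟨β', hc, rfl⟩
  have hch : hex.choose = β' :=
    (comp_left_cancel β β' hex.choose hc hex.choose_spec.1 hex.choose_spec.2).symm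
  simp only [sgeMul]
  rw [if_pos hwf, dif_pos hex, hch]

theorem sgeMul_same (α β δ : Path S) (g h : S.G) (h1 : S.gr g = α.src) (h2 : S.gs g = β.src)
    (h3 : S.gr h = β.src) (h4 : S.gs h = δ.src) :
    sgeMul S (some (α, g, β)) (some (β, h, δ)) = some (α, S.mul g h, δ) := by
  have := sgeMul_left α β δ (Path.vert S β.src) g h h1 h2 h3 h4 rfl
  rw [comp_vert _ _ rfl] at this
  rw [this]
  have e : pact S g (Path.vert S β.src) = Path.vert S (S.gr g) := rfl
  rw [e, comp_vert _ _ h1.symm]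
  rfl

/-- nonzero products have comparable middle paths -/
theorem sgeMul_cases (α β γ δ : Path S) (g h : S.G) (x : Path S × S.G × Path S)
    (hx : sgeMul S (some (α, g, β)) (some (γ, h, δ)) = some x) :
    (∃ β', β.src = Path.rng β' ∧ γ = β.comp β' ∧
      x = (α.comp (pact S g β'), S.mul (pres S g β') h, δ)) ∨
    (∃ γ', γ.src = Path.rng γ' ∧ β = γ.comp γ' ∧
      x = (α, S.mul g (S.inv (pres S (S.inv h) γ')), δ.comp (pact S (S.inv h) γ'))) := by
  simp only [sgeMul] at hx
  split_ifs at hx with a b c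
  · exact Or.inl ⟨b.choose, b.choose_spec.1, b.choose_spec.2, (Option.some.inj hx).symm⟩
  · exact Or.inr ⟨c.choose, c.choose_spec.1, c.choose_spec.2, (Option.some.inj hx).symm⟩

theorem fIdem_idem (γ : Path S) : sgeMul S (fIdem S γ) (fIdem S γ) = fIdem S γ := by
  unfold fIdem
  rw [sgeMul_same _ _ _ _ _ (S.gr_one _) (S.gs_one _) (S.gr_one _) (S.gs_one _), one_mul_one]

theorem fIdem_star (γ : Path S) : sgeStar S (fIdem S γ) = fIdem S γ := by
  simp only [fIdem, sgeStar, inv_one]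

theorem list_nil_of_len {p q : Path S} (h : p.toList.length = q.toList.length)
    (hp : p.toList = []) : q.toList = [] := by
  rw [hp] at h
  exact List.length_eq_zero_iff.mp h.symm

theorem nzIdem_eq (e : SGE S) (he : (sgeSem S).NzIdem e) : ∃ γ, e = fIdem S γ := by
  obtain ⟨hd, hm, hz⟩ := he
  rcases e with _ | ⟨γ, h, δ⟩
  · exact absurd rfl hz
  obtain ⟨d1, d2⟩ : S.gr h = γ.src ∧ S.gs h = δ.src := hd
  change sgeMul S (some (γ, h, δ)) (some (γ, h, δ)) = some (γ, h, δ) at hm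
  have key : γ = δ := by
    rcases sgeMul_cases _ _ _ _ _ _ _ hm with ⟨b, w, e1, e2⟩ | ⟨b, w, e1, e2⟩
    · simp only [Prod.mk.injEq] at e2
      have wb : S.gs h = b.rng := d2.trans w
      have hn := comp_eq_self γ (pact S h b) (by rw [pact_rng _ _ wb, d1]) e2.1.symm
      have hb := list_nil_of_len (pact_len h b wb) hn
      rw [e1, eq_vert b hb, comp_vert _ _ w]
    · simp only [Prod.mk.injEq] at e2
      have wb : S.gs (S.inv h) = b.rng := by rw [S.gs_inv, d1, w]
      have hn := comp_eq_self δ (pact S (S.inv h) b)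
        (by rw [pact_rng _ _ wb, S.gr_inv, d2]) e2.2.2.symm
      have hb := list_nil_of_len (pact_len _ b wb) hn
      rw [e1, eq_vert b hb, comp_vert _ _ w]
  subst key
  rw [sgeMul_same _ _ _ _ _ d1 d2 d1 d2] at hm
  have hh : S.mul h h = h := by simpa using hm
  have := idem_one h (d2.trans d1.symm) hh
  exact ⟨γ, by unfold fIdem; rw [← d2, ← this]⟩

end Aux

end SSA

/-- Equivalent characterisations of pseudo freeness: no non-unit
strongly fixes an edge; no non-unit strongly fixes a path; cancellation
`g·α = h·α ∧ g|_α = h|_α → g = h`; `S(G,E)` is `E*`-unitary; and the Zappa–Szép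
product category `E^* ⋈ G` is right cancellative. -/
theorem statement13 (S : SSA) :
    List.TFAE [
      ∀ (g : S.G) (e : S.E), S.gs g = S.er e → S.act g e = e →
        S.res g e = S.one (S.es e) → SSA.IsUnitArrow S g,
      ∀ (g : S.G) (p : SSA.Path S), SSA.SFix S g p → SSA.IsUnitArrow S g,
      ∀ (α : SSA.Path S) (g h : S.G), S.gs g = α.rng → S.gs h = α.rng →
        SSA.pact S g α = SSA.pact S h α → SSA.pres S g α = SSA.pres S h α → g = h,
      (SSA.sgeSem S).EUnitary,
      ∀ (μ μ' ν : SSA.Path S) (g g' h : S.G),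
        μ.src = S.gr g → μ'.src = S.gr g' → ν.src = S.gr h →
        S.gs g = ν.rng → S.gs g' = ν.rng →
        μ.comp (SSA.pact S g ν) = μ'.comp (SSA.pact S g' ν) →
        S.mul (SSA.pres S g ν) h = S.mul (SSA.pres S g' ν) h →
        μ = μ' ∧ g = g'] := by
  tfae_have 1 → 2 := by
    intro H g p
    induction p using SSA.path_ind generalizing g with
    | h0 v =>
      rintro ⟨a, b, c⟩
      change S.gs g = v at a
      change g = S.one v at c
      rw [SSA.IsUnitArrow, a]; exact c
    | h1 e q h ih =>
      rintro ⟨a, b, c⟩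
      have a' : S.gs g = S.er e := a.trans (SSA.comp_rng _ _ h)
      obtain ⟨h1, h2⟩ := SSA.pact_cons g e q h
      have w : S.gs (S.res g e) = q.rng := (S.gs_res g e a').trans h
      rw [h1] at b
      rw [h2, SSA.comp_src _ _ h] at c
      obtain ⟨b1, b2⟩ := SSA.comp_cancel _ _ _ _
        (show S.es (S.act g e) = _ by rw [SSA.pact_rng _ _ w, S.gr_res g e a'])
        h b (SSA.pact_len _ _ w)
      have b3 : S.act g e = e := by
        have := congrArg SSA.Path.toList b1
        simpa [SSA.Path.ofEdge, SSA.Path.toList, SSA.Pth.toList] using this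
      have u := ih (S.res g e) ⟨w, b2, c⟩
      rw [SSA.IsUnitArrow, S.gs_res g e a'] at u
      exact H g e a' b3 u
  tfae_have 2 → 1 := by
    intro H g e w h1 h2
    refine H g (SSA.Path.ofEdge S e) ⟨w, ?_, h2⟩
    change (SSA.Path.ofEdge S (S.act g e)).comp (SSA.Path.vert S (S.gr (S.res g e))) = _
    rw [SSA.comp_vert _ _ (S.gr_res g e w).symm, h1]
  tfae_have 2 → 3 := by
    intro H α g h wg wh e1 e2
    have hr : S.gr g = S.gr h := by
      rw [← SSA.pact_rng _ _ wg, ← SSA.pact_rng _ _ wh, e1]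
    have w1 : S.gs (S.inv h) = S.gr g := by rw [S.gs_inv, hr]
    obtain ⟨m1, m2⟩ := SSA.pact_mul α (S.inv h) g w1 wg
    obtain ⟨n1, n2⟩ := SSA.pact_mul α (S.inv h) h (S.gs_inv h) wh
    rw [e1, ← n1] at m1
    rw [e1, e2, ← n2] at m2
    rw [S.inv_mul', wh] at m1 m2
    rw [(SSA.pact_one α).1] at m1
    rw [(SSA.pact_one α).2] at m2
    have u := H (S.mul (S.inv h) g) α ⟨(S.gs_mul _ _ w1).trans wg, m1, m2⟩
    rw [SSA.IsUnitArrow, S.gs_mul _ _ w1, wg, ← wh] at u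
    have k := SSA.inv_mul_cancel_left (S.inv h) g w1
    rw [u, SSA.inv_inv', S.mul_one'] at k
    exact k.symm
  tfae_have 3 → 2 := by
    rintro H g p ⟨w, h1, h2⟩
    obtain ⟨o1, o2⟩ := SSA.pact_one p
    rw [SSA.IsUnitArrow, w]
    exact H p g _ w (S.gs_one _) (h1.trans o1.symm) (h2.trans o2.symm)
  tfae_have 2 → 4 := by
    intro H t e ht he hle
    obtain ⟨γ, rfl⟩ := SSA.nzIdem_eq e he
    change SSA.fIdem S γ =
      SSA.sgeMul S t (SSA.sgeMul S (SSA.sgeStar S (SSA.fIdem S γ)) (SSA.fIdem S γ)) at hle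
    rw [SSA.fIdem_star, SSA.fIdem_idem] at hle
    rcases t with _ | ⟨α, g, β⟩
    · rfl
    obtain ⟨d1, d2⟩ : S.gr g = α.src ∧ S.gs g = β.src := ht
    have key : α = β ∧ SSA.IsUnitArrow S g := by
      rcases SSA.sgeMul_cases _ _ _ _ _ _ _ hle.symm with ⟨b, w, e1, e2⟩ | ⟨b, w, e1, e2⟩
      · simp only [Prod.mk.injEq] at e2
        obtain ⟨e2, e3, -⟩ := e2
        have wb : S.gs g = b.rng := d2.trans w
        have hs : γ.src = b.src := by rw [e1, SSA.comp_src _ _ w]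
        rw [hs, ← SSA.pres_gs g b wb, S.mul_one', SSA.pres_gs g b wb] at e3
        rw [e1] at e2
        obtain ⟨k1, k2⟩ := SSA.comp_cancel _ _ _ _ w
          (by rw [SSA.pact_rng _ _ wb, d1]) e2 (SSA.pact_len g b wb).symm
        exact ⟨k1.symm, H g b ⟨wb, k2.symm, e3.symm⟩⟩
      · simp only [Prod.mk.injEq, SSA.inv_one] at e2
        obtain ⟨e2, e3, e4⟩ := e2
        rw [w, (SSA.pact_one b).1] at e4
        have hb := SSA.comp_eq_self γ b w e4.symm
        have hbv := SSA.eq_vert b hb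
        have e5 : β = γ := by rw [e1, hbv, SSA.comp_vert _ _ w]
        rw [w, (SSA.pact_one b).2, SSA.inv_one] at e3
        have hbs : b.src = S.gs g := by
          rw [d2, e1, SSA.comp_src _ _ w]
        rw [hbs, S.mul_one'] at e3
        refine ⟨e2.symm.trans e5.symm, ?_⟩
        rw [SSA.IsUnitArrow, ← e3, S.gs_one]
    obtain ⟨rfl, hu⟩ := key
    have : (some (α, g, α) : SSA.SGE S) = SSA.fIdem S α := by
      rw [SSA.fIdem, ← d2, ← hu]
    rw [this]
    exact SSA.fIdem_idem α
  tfae_have 4 → 2 := by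
    rintro H g p ⟨w, h1, h2⟩
    have hr : S.gr g = p.rng := by rw [← SSA.pact_rng g p w, h1]
    have key := H (some (SSA.Path.vert S p.rng, g, SSA.Path.vert S p.rng)) (SSA.fIdem S p)
      ⟨hr, w⟩ ⟨⟨S.gr_one _, S.gs_one _⟩, SSA.fIdem_idem p, by intro h; cases h⟩ (by
        change SSA.fIdem S p = SSA.sgeMul S _
          (SSA.sgeMul S (SSA.sgeStar S (SSA.fIdem S p)) (SSA.fIdem S p))
        rw [SSA.fIdem_star, SSA.fIdem_idem]
        have := SSA.sgeMul_left (SSA.Path.vert S p.rng) (SSA.Path.vert S p.rng) p p g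
          (S.one p.src) hr w (S.gr_one _) (S.gs_one _) rfl
        rw [h1, h2, SSA.vert_comp _ _ rfl, SSA.one_mul_one] at this
        exact this.symm)
    change SSA.sgeMul S (some (SSA.Path.vert S p.rng, g, SSA.Path.vert S p.rng))
      (some (SSA.Path.vert S p.rng, g, SSA.Path.vert S p.rng)) = _ at key
    rw [SSA.sgeMul_same _ _ _ _ _ hr w hr w] at key
    exact SSA.idem_one g (w.trans hr.symm) (by simpa using key)
  tfae_have 3 → 5 := by
    intro H μ μ' ν g g' h w1 w2 w3 w4 w5 e1 e2
    have e3 := SSA.mul_right_cancel _ _ _ ((SSA.pres_gs g ν w4).trans w3)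
      ((SSA.pres_gs g' ν w5).trans w3) e2
    obtain ⟨k1, k2⟩ := SSA.comp_cancel _ _ _ _
      (by rw [SSA.pact_rng _ _ w4, w1]) (by rw [SSA.pact_rng _ _ w5, w2]) e1
      (by rw [SSA.pact_len _ _ w4, SSA.pact_len _ _ w5])
    exact ⟨k1, H ν g g' w4 w5 k2 e3⟩
  tfae_have 5 → 3 := by
    intro H α g h wg wh e1 e2
    refine (H (SSA.Path.vert S (S.gr g)) (SSA.Path.vert S (S.gr h)) α g h (S.one α.src)
      rfl rfl (S.gr_one _).symm wg wh ?_ (by rw [e2])).2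
    rw [SSA.vert_comp _ _ (SSA.pact_rng _ _ wg).symm,
      SSA.vert_comp _ _ (SSA.pact_rng _ _ wh).symm, e1]
  tfae_finish

end
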